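/- Order preserving property: assume β ≤ 2zn. Then there exists a covering configuration y = (y_1, …, y_n) with y_1 ≤ y_2 ≤ ⋯ ≤ y_n whose cost is less than or equal to the cost of every covering configuration; that is, there is an optimal solution in which the left-to-right order of the sensors is the same as in the input. -/

import Mathlib

/-- A configuration `y` of the `n` sensors (with covering range `z`) covers the
barrier `[0, β]`. -/
def Covers (n : ℕ) (z β : ℝ) (y : ℕ → ℝ) : Prop :=
  Set.Icc (0 : ℝ) β ⊆ ⋃ i ∈ Finset.Icc 1 n, Set.Icc (y i - z) (y i + z)

/-- The cost of moving the sensors from positions `x` to positions `y`. -/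
noncomputable def Cost (n : ℕ) (x y : ℕ → ℝ) : ℝ :=
  ∑ i ∈ Finset.Icc 1 n, |x i - y i|

/-- The optimal (infimum) cost over all covering configurations. -/
noncomputable def OptCost (n : ℕ) (z β : ℝ) (x : ℕ → ℝ) : ℝ :=
  sInf {c : ℝ | ∃ y : ℕ → ℝ, Covers n z β y ∧ c = Cost n x y}

open Finset in
/-- The effect on a sum `∑ F j (y j)` of exchanging two neighbouring entries of `y`. -/
lemma sum_swap_sub_sum {n i : ℕ} (hi : 1 ≤ i) (hin : i < n) (F : ℕ → ℝ → ℝ) (y : ℕ → ℝ) :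
    ∑ j ∈ Icc 1 n, F j (y (Equiv.swap i (i + 1) j)) - ∑ j ∈ Icc 1 n, F j (y j) =
      (F i (y (i + 1)) - F i (y i)) + (F (i + 1) (y i) - F (i + 1) (y (i + 1))) := by
  rw [← sum_sub_distrib]
  have hsub : ({i, i + 1} : Finset ℕ) ⊆ Icc 1 n := by
    intro j hj
    simp only [mem_insert, mem_singleton] at hj
    simp only [mem_Icc]
    omega
  rw [← sum_subset hsub, sum_pair (by omega)]
  · simp
  · intro j _ hj
    simp only [mem_insert, mem_singleton, not_or] at hj
    rw [Equiv.swap_apply_of_ne_of_ne hj.1 hj.2, sub_self]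

lemma abs_sub_add_abs_sub_le_of_le {a b u v : ℝ} (hab : a ≤ b) (huv : u ≤ v) :
    |a - u| + |b - v| ≤ |a - v| + |b - u| := by
  rcases abs_cases (a - u) with h₁ | h₁ <;> rcases abs_cases (b - v) with h₂ | h₂ <;>
    rcases abs_cases (a - v) with h₃ | h₃ <;> rcases abs_cases (b - u) with h₄ | h₄ <;>
    linarith

lemma covers_iff {n : ℕ} {z β : ℝ} {y : ℕ → ℝ} :
    Covers n z β y ↔
      ∀ t ∈ Set.Icc 0 β, ∃ i ∈ Finset.Icc 1 n, t ∈ Set.Icc (y i - z) (y i + z) := by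
  simp only [Covers, Set.subset_def, Set.mem_iUnion, exists_prop]

lemma isClosed_setOf_covers (n : ℕ) (z β : ℝ) : IsClosed {y | Covers n z β y} := by
  have h : {y | Covers n z β y} = ⋂ t ∈ Set.Icc (0 : ℝ) β, ⋃ i ∈ Finset.Icc 1 n,
      {y : ℕ → ℝ | y i - z ≤ t ∧ t ≤ y i + z} := by
    ext y
    simp only [Set.mem_ofPred_eq, covers_iff, Set.mem_iInter, Set.mem_iUnion, exists_prop,
      Set.mem_Icc]
  rw [h]
  refine isClosed_biInter fun t _ => isClosed_biUnion_finset fun i _ => ?_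
  have hl : IsClosed {y : ℕ → ℝ | y i - z ≤ t} := isClosed_le (by fun_prop) (by fun_prop)
  have hr : IsClosed {y : ℕ → ℝ | t ≤ y i + z} := isClosed_le (by fun_prop) (by fun_prop)
  exact hl.inter hr

lemma continuous_cost (n : ℕ) (x : ℕ → ℝ) : Continuous (Cost n x) := by
  unfold Cost
  fun_prop

lemma abs_sub_le_cost {n i : ℕ} (x y : ℕ → ℝ) (hi : i ∈ Finset.Icc 1 n) :
    |x i - y i| ≤ Cost n x y :=
  Finset.single_le_sum (f := fun j => |x j - y j|) (fun _ _ => abs_nonneg _) hi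

lemma cost_nonneg (n : ℕ) (x y : ℕ → ℝ) : 0 ≤ Cost n x y :=
  Finset.sum_nonneg fun _ _ => abs_nonneg _

/-- Placing the sensors side by side from the left end covers the barrier. -/
lemma covers_side_by_side {n : ℕ} {z β : ℝ} (hn : 1 ≤ n) (hz : 0 < z)
    (hfeas : β ≤ 2 * z * n) : Covers n z β fun i => (2 * i - 1) * z := by
  rw [covers_iff]
  rintro t ⟨ht0, htβ⟩
  rcases ht0.eq_or_lt with rfl | ht
  · exact ⟨1, by simp [hn], by constructor <;> push_cast <;> linarith⟩
  have hpos : 0 < t / (2 * z) := by positivity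
  have hle : t / (2 * z) ≤ n := by
    rw [div_le_iff₀ (by positivity)]
    linarith
  refine ⟨⌈t / (2 * z)⌉₊, Finset.mem_Icc.2 ⟨Nat.ceil_pos.2 hpos, Nat.ceil_le.2 hle⟩, ?_⟩
  have h1 := Nat.le_ceil (t / (2 * z))
  have h2 := Nat.ceil_lt_add_one hpos.le
  rw [div_le_iff₀ (by positivity)] at h1
  rw [← sub_lt_iff_lt_add, lt_div_iff₀ (by positivity)] at h2
  constructor <;> linarith

/-- The covering configurations of cost at most `C`, normalized to agree with `x` at the indices
that do not label a sensor. -/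
def coveringSublevel (n : ℕ) (z β : ℝ) (x : ℕ → ℝ) (C : ℝ) : Set (ℕ → ℝ) :=
  {y | Covers n z β y ∧ (∀ i ∉ Finset.Icc 1 n, y i = x i) ∧ Cost n x y ≤ C}

lemma isCompact_coveringSublevel (n : ℕ) (z β : ℝ) (x : ℕ → ℝ) (C : ℝ) :
    IsCompact (coveringSublevel n z β x C) := by
  refine (isCompact_univ_pi fun i => isCompact_Icc (a := x i - C) (b := x i + C)).of_isClosed_subset
    ?_ ?_
  · have hout : IsClosed {y : ℕ → ℝ | ∀ i ∉ Finset.Icc 1 n, y i = x i} := by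
      simp only [Set.ofPred_forall]
      exact isClosed_iInter fun i => isClosed_iInter fun _ =>
        isClosed_eq (by fun_prop) (by fun_prop)
    exact (isClosed_setOf_covers n z β).inter
      (hout.inter (isClosed_le (continuous_cost n x) continuous_const))
  · rintro y ⟨-, hout, hcost⟩ i -
    have hi : |x i - y i| ≤ C := by
      by_cases hi : i ∈ Finset.Icc 1 n
      · exact (abs_sub_le_cost x y hi).trans hcost
      · simpa [hout i hi] using (cost_nonneg n x y).trans hcost
    rw [abs_le] at hi
    constructor <;> linarith [hi.1, hi.2]

/-- Every covering configuration of cost at most `C` can be normalized outside the sensor labels. -/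
lemma exists_mem_coveringSublevel {n : ℕ} {z β C : ℝ} {x y : ℕ → ℝ} (hy : Covers n z β y)
    (hC : Cost n x y ≤ C) : ∃ y' ∈ coveringSublevel n z β x C, Cost n x y' = Cost n x y := by
  let y' : ℕ → ℝ := fun i => if i ∈ Finset.Icc 1 n then y i else x i
  have heq : ∀ i ∈ Finset.Icc 1 n, y' i = y i := fun i hi => if_pos hi
  have hcost : Cost n x y' = Cost n x y :=
    Finset.sum_congr rfl fun i hi => by rw [heq i hi]
  refine ⟨y', ⟨covers_iff.2 fun t ht => ?_, fun i hi => if_neg hi, hcost.trans_le hC⟩, hcost⟩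
  obtain ⟨i, hi, hti⟩ := covers_iff.1 hy t ht
  exact ⟨i, hi, by rwa [heq i hi]⟩

lemma exists_covers_forall_cost_le {n : ℕ} {z β : ℝ} {y₀ : ℕ → ℝ} (x : ℕ → ℝ)
    (h₀ : Covers n z β y₀) :
    ∃ y, Covers n z β y ∧ ∀ y', Covers n z β y' → Cost n x y ≤ Cost n x y' := by
  obtain ⟨y₁, hy₁, h₁⟩ := exists_mem_coveringSublevel (x := x) h₀ le_rfl
  obtain ⟨y, hy, hmin⟩ := (isCompact_coveringSublevel n z β x (Cost n x y₀)).exists_isMinOn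
    ⟨y₁, hy₁⟩ (continuous_cost n x).continuousOn
  refine ⟨y, hy.1, fun y' hy' => ?_⟩
  rcases le_total (Cost n x y') (Cost n x y₀) with h | h
  · obtain ⟨y₂, hy₂, h₂⟩ := exists_mem_coveringSublevel (x := x) hy' h
    exact (hmin hy₂).trans h₂.le
  · exact hy.2.2.trans h

lemma swap_mem_Icc_iff {n i j : ℕ} (hi : 1 ≤ i) (hin : i < n) :
    Equiv.swap i (i + 1) j ∈ Finset.Icc 1 n ↔ j ∈ Finset.Icc 1 n := by
  simp only [Equiv.swap_apply_def, Finset.mem_Icc]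
  split_ifs <;> omega

/-- Exchanging two neighbouring sensors that are out of order keeps a configuration in the
sublevel set. -/
lemma swap_mem_coveringSublevel {n i : ℕ} {z β C : ℝ} {x y : ℕ → ℝ} (hi : 1 ≤ i) (hin : i < n)
    (hx : x i ≤ x (i + 1)) (hyi : y (i + 1) ≤ y i) (hy : y ∈ coveringSublevel n z β x C) :
    (fun j => y (Equiv.swap i (i + 1) j)) ∈ coveringSublevel n z β x C := by
  obtain ⟨hcov, hout, hcost⟩ := hy
  refine ⟨covers_iff.2 fun t ht => ?_, fun j hj => ?_, ?_⟩
  · obtain ⟨j, hj, htj⟩ := covers_iff.1 hcov t ht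
    exact ⟨Equiv.swap i (i + 1) j, (swap_mem_Icc_iff hi hin).2 hj, by simpa using htj⟩
  · have hji : j ≠ i ∧ j ≠ i + 1 := by
      rw [Finset.mem_Icc] at hj
      omega
    simp only [Equiv.swap_apply_of_ne_of_ne hji.1 hji.2, hout j hj]
  · have h := sum_swap_sub_sum hi hin (fun j t => |x j - t|) y
    have h' := abs_sub_add_abs_sub_le_of_le hx hyi
    unfold Cost at hcost ⊢
    linarith

/-- Order preserving property: if `β ≤ 2zn`, there is an optimal covering
configuration in which the left-to-right order of the sensors is the same as in the
(sorted) input. -/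
theorem order_preserving_property
    (n : ℕ) (z β : ℝ) (x : ℕ → ℝ)
    (hn : 1 ≤ n) (hz : 0 < z) (hβ : 0 < β)
    (hsort : ∀ i, 1 ≤ i → i < n → x i ≤ x (i + 1))
    (hfeas : β ≤ 2 * z * n) :
    ∃ y : ℕ → ℝ, Covers n z β y ∧
      (∀ i, 1 ≤ i → i < n → y i ≤ y (i + 1)) ∧
      (∀ y' : ℕ → ℝ, Covers n z β y' → Cost n x y ≤ Cost n x y') := by
  obtain ⟨w, hw, hmin⟩ := exists_covers_forall_cost_le x (covers_side_by_side hn hz hfeas)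
  obtain ⟨w', hw', -⟩ := exists_mem_coveringSublevel (x := x) hw le_rfl
  -- Among the optimal configurations, one that maximizes `∑ j * y j` is sorted.
  obtain ⟨y, hy, hmax⟩ := (isCompact_coveringSublevel n z β x (Cost n x w)).exists_isMaxOn
    ⟨w', hw'⟩ (f := fun y => ∑ j ∈ Finset.Icc 1 n, (j : ℝ) * y j)
    (Continuous.continuousOn (by fun_prop))
  refine ⟨y, hy.1, fun i hi hin => ?_, fun y' hy' => hy.2.2.trans (hmin y' hy')⟩
  by_contra! hlt
  have h := hmax (swap_mem_coveringSublevel hi hin (hsort i hi hin) hlt.le hy)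
  have h' := sum_swap_sub_sum hi hin (fun j t => (j : ℝ) * t) y
  simp only [Set.mem_ofPred_eq] at h
  push_cast at h'
  linarith
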